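/- Fix an integer n ≥ 4. The mixing time t_n of the adjacent-swap chain on the unlabeled constrained ordered matchings COM_n satisfies t_n ≤ (8/3)·n⁴, and there exists a constant C > 0 such that the mixing time t_n^L of the adjacent-swap chain on the labeled constrained ordered matchings COM^L_n satisfies t_n^L ≤ C·n⁴ for all n ≥ 4. -/

import Mathlib

open Finset

/-- Labels for a labeled constrained ordered matching of order `n`:
`Sum.inl i` is the leaf label `ℓ_{i+1}`, and `Sum.inr j` is the internal label `j+1`. -/
abbrev LLabel (n : ℕ) := Fin n ⊕ Fin (n - 2)

/-- `p` is a labeled constrained ordered matching: the pairs `p 0, …, p (n-2)`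
(0-indexed versions of `p_1, …, p_{n-1}`) have size two, partition the label set,
and the internal label `j+1` (i.e. `Sum.inr j`) may only appear in pair `p_k`
(1-indexed pair `k+1`) when `j + 1 < k + 1`. -/
def IsLCOM (n : ℕ) (p : Fin (n - 1) → Finset (LLabel n)) : Prop :=
  (∀ k, (p k).card = 2) ∧
  (∀ a : LLabel n, ∃ k, a ∈ p k ∧ ∀ k', a ∈ p k' → k' = k) ∧
  (∀ (j : Fin (n - 2)) (k : Fin (n - 1)), Sum.inr j ∈ p k → (j : ℕ) < (k : ℕ))

instance (n : ℕ) : DecidablePred (IsLCOM n) := fun _ => by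
  unfold IsLCOM; infer_instance

/-- The set of labeled constrained ordered matchings `COM^L_n`. -/
abbrev LCOM (n : ℕ) : Type := {p : Fin (n - 1) → Finset (LLabel n) // IsLCOM n p}

/-- Index of the pair `p_k` (1-indexed `k ∈ {1,…,n-2}`) as an element of `Fin (n-1)`. -/
def idx1 {n : ℕ} (k : Fin (n - 2)) : Fin (n - 1) := ⟨k, by have := k.isLt; omega⟩

/-- Index of the pair `p_{k+1}` as an element of `Fin (n-1)`. -/
def idx2 {n : ℕ} (k : Fin (n - 2)) : Fin (n - 1) := ⟨(k : ℕ) + 1, by have := k.isLt; omega⟩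

/-- Result of exchanging label `l1` from pair `k` with label `l2` from pair `k+1`. -/
def lswapFun (n : ℕ) (p : Fin (n - 1) → Finset (LLabel n)) (k : Fin (n - 2))
    (l1 l2 : LLabel n) : Fin (n - 1) → Finset (LLabel n) :=
  fun i =>
    if i = idx1 k then insert l2 ((p (idx1 k)).erase l1)
    else if i = idx2 k then insert l1 ((p (idx2 k)).erase l2)
    else p i

/-- The state obtained from `x` when attempting to exchange `l1 ∈ p_k` with `l2 ∈ p_{k+1}`:
the swap is performed if it yields a valid constrained ordered matching,
otherwise the chain stays at `x`. -/
def lswapDest (n : ℕ) (x : LCOM n) (k : Fin (n - 2)) (l1 l2 : LLabel n) :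
    Fin (n - 1) → Finset (LLabel n) :=
  if IsLCOM n (lswapFun n x.val k l1 l2) then lswapFun n x.val k l1 l2 else x.val

/-- Transition matrix of the adjacent-swap Markov chain on `COM^L_n`:
pick `k ∈ {1,…,n-2}` uniformly, pick `l1` uniformly from the two elements of `p_k`
and `l2` uniformly from the two elements of `p_{k+1}`, and swap them if allowed. -/
noncomputable def PL (n : ℕ) (x y : LCOM n) : ℝ :=
  (1 / ((n : ℝ) - 2)) * ∑ k : Fin (n - 2), ∑ l1 ∈ x.val (idx1 k), ∑ l2 ∈ x.val (idx2 k),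
    (1 / 4 : ℝ) * (if lswapDest n x k l1 l2 = y.val then 1 else 0)

/-- The adjacent-swap transition matrix on `COM^L_n` as a matrix. -/
noncomputable def PLmat (n : ℕ) : Matrix (LCOM n) (LCOM n) ℝ := Matrix.of (PL n)

/-- `p` is an unlabeled constrained ordered matching: each `p k` is a multiset of size two
over the symbols `Fin (n-1)` (symbol `0` stands for a leaf, symbol `j ≠ 0` for the internal
label `j`); across all pairs the symbol `0` appears `n` times and each internal label once;
and the internal label `j` may only appear in pair `p k` (1-indexed pair `k+1`) when 
`j < k + 1`, i.e. `j ≤ k`. -/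
def IsUCOMraw (n : ℕ) (p : Fin (n - 1) → Multiset (Fin (n - 1))) : Prop :=
  (∀ k, Multiset.card (p k) = 2) ∧
  (∀ s : Fin (n - 1), (∑ k, (p k).count s) = if (s : ℕ) = 0 then n else 1) ∧
  (∀ (j k : Fin (n - 1)), (j : ℕ) ≠ 0 → j ∈ p k → (j : ℕ) ≤ (k : ℕ))

instance (n : ℕ) : DecidablePred (IsUCOMraw n) := fun _ => by
  unfold IsUCOMraw; infer_instance

instance (n : ℕ) :
    DecidablePred (fun p : Fin (n - 1) → Sym (Fin (n - 1)) 2 =>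
      IsUCOMraw n (fun k => (p k : Multiset (Fin (n - 1))))) := fun _ => by
  infer_instance

/-- The set of unlabeled constrained ordered matchings `COM_n`; each pair is stored as an
unordered pair with possible repetition (`Sym _ 2`), with the validity predicate imposed on
the underlying multisets. -/
abbrev UCOM (n : ℕ) : Type :=
  {p : Fin (n - 1) → Sym (Fin (n - 1)) 2 //
    IsUCOMraw n (fun k => (p k : Multiset (Fin (n - 1))))}

/-- The sequence of size-two multisets underlying an unlabeled constrained ordered matching. -/
def uraw (n : ℕ) (x : UCOM n) : Fin (n - 1) → Multiset (Fin (n - 1)) :=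
  fun k => (x.val k : Multiset (Fin (n - 1)))

/-- Result of exchanging symbol `l1` from pair `k` with symbol `l2` from pair `k+1`. -/
def uswapFun (n : ℕ) (p : Fin (n - 1) → Multiset (Fin (n - 1))) (k : Fin (n - 2))
    (l1 l2 : Fin (n - 1)) : Fin (n - 1) → Multiset (Fin (n - 1)) :=
  fun i =>
    if i = idx1 k then l2 ::ₘ (p (idx1 k)).erase l1
    else if i = idx2 k then l1 ::ₘ (p (idx2 k)).erase l2
    else p i

/-- The state obtained from `x` when attempting to exchange `l1 ∈ p_k` with `l2 ∈ p_{k+1}`: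
the swap is performed if it yields a valid constrained ordered matching,
otherwise the chain stays at `x`. -/
def uswapDest (n : ℕ) (x : UCOM n) (k : Fin (n - 2)) (l1 l2 : Fin (n - 1)) :
    Fin (n - 1) → Multiset (Fin (n - 1)) :=
  if IsUCOMraw n (uswapFun n (uraw n x) k l1 l2) then uswapFun n (uraw n x) k l1 l2
  else uraw n x

/-- Transition matrix of the adjacent-swap Markov chain on `COM_n`:
pick `k ∈ {1,…,n-2}` uniformly, pick `l1` uniformly from the multiset `p_k`
and `l2` uniformly from the multiset `p_{k+1}` (each of the two slots of a pair
with probability 1/2), and swap them if allowed. -/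
noncomputable def PU (n : ℕ) (x y : UCOM n) : ℝ :=
  (1 / ((n : ℝ) - 2)) * ∑ k : Fin (n - 2),
    ((uraw n x (idx1 k)).map (fun l1 =>
      ((uraw n x (idx2 k)).map (fun l2 =>
        (1 / 4 : ℝ) * (if uswapDest n x k l1 l2 = uraw n y then 1 else 0))).sum)).sum

/-- The adjacent-swap transition matrix on `COM_n` as a matrix. -/
noncomputable def PUmat (n : ℕ) : Matrix (UCOM n) (UCOM n) ℝ := Matrix.of (PU n)

/-- The number of cherries of `T`: pairs all of whose elements are the leaf symbol `0`,
i.e. pairs equal to `{0,0}`. -/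
def cherries (n : ℕ) (T : UCOM n) : ℕ :=
  (Finset.univ.filter (fun k : Fin (n - 1) => ∀ a ∈ uraw n T k, (a : ℕ) = 0)).card

/-- The Tajima coalescent distribution on `COM_n`. -/
noncomputable def tajima (n : ℕ) (T : UCOM n) : ℝ :=
  (2 : ℝ) ^ (n - cherries n T - 1) / (Nat.factorial (n - 1))

/-- The (1-indexed, shifted down by one) index of the pair containing the internal label `j`:
`Ix n x j` is the unique `k` (0-indexed) with `j ∈ p_{k+1}`, so that `I_x(j) = Ix n x j + 1`. -/
noncomputable def Ix (n : ℕ) (x : UCOM n) (j : Fin (n - 1)) : ℕ :=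
  sInf {k : ℕ | ∃ h : k < n - 1, j ∈ uraw n x ⟨k, h⟩}

/-- The internal tree length `φ(x) = ∑_{j=1}^{n-2} (I_x(j) - j)`. -/
noncomputable def itl (n : ℕ) (x : UCOM n) : ℤ :=
  ∑ j ∈ Finset.univ.filter (fun j : Fin (n - 1) => (j : ℕ) ≠ 0),
    ((Ix n x j : ℤ) + 1 - (j : ℤ))

/-- The largest absolute value of an eigenvalue of `M` different from the eigenvalue `1`. -/
noncomputable def lamStar {S : Type*} [Fintype S] [DecidableEq S] (M : Matrix S S ℝ) : ℝ :=
  sSup {r : ℝ | ∃ μ : ℝ, μ ≠ 1 ∧ Module.End.HasEigenvalue (Matrix.toLin' M) μ ∧ r = |μ|}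

/-- The spectral gap `γ = 1 - λ*` of a transition matrix `M`. -/
noncomputable def specGap {S : Type*} [Fintype S] [DecidableEq S] (M : Matrix S S ℝ) : ℝ :=
  1 - lamStar M

/-- Mixing time of a chain with transition matrix `M` and stationary distribution `π`:
`max_{x₀} min { t ≥ 0 : ‖M^t(x₀,·) − π‖_TV < 1/4 }`. -/
noncomputable def mixingTime {S : Type*} [Fintype S] [DecidableEq S]
    (M : Matrix S S ℝ) (π : S → ℝ) : ℕ :=
  Finset.univ.sup fun x0 : S =>
    sInf {t : ℕ | (1 / 2 : ℝ) * ∑ y : S, |(M ^ t) x0 y - π y| < 1 / 4}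

/-- The uniform distribution on `COM^L_n`. -/
noncomputable def unifL (n : ℕ) : LCOM n → ℝ := fun _ => 1 / (Fintype.card (LCOM n) : ℝ)

/-- The mixing time `t_n` of the adjacent-swap chain on `COM_n`
(with Tajima stationary distribution). -/
noncomputable def tU (n : ℕ) : ℕ := mixingTime (PUmat n) (tajima n)

/-- The mixing time `t_n^L` of the adjacent-swap chain on `COM^L_n`
(with uniform stationary distribution). -/
noncomputable def tL (n : ℕ) : ℕ := mixingTime (PLmat n) (unifL n)


section Abstract
variable {S U Ω : Type*} [Fintype S] [DecidableEq S] [Fintype U] [DecidableEq U] [Fintype Ω]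

/-- Coupling disagreement probabilities. -/
noncomputable def cpl (h : S → U) (T : Ω → S → S) (al : S → S → S) : ℕ → S → S → ℝ
  | 0, x, y => if h x = h y then 0 else 1
  | t + 1, x, y => if h x = h y then 0 else
      (1 / (Fintype.card Ω : ℝ)) * ∑ ω, cpl h T al t (T ω x) (T ω (al x y))

theorem mulVec_h (h : S → U) (T : Ω → S → S) (Pm : Matrix U U ℝ)
    (hP : ∀ x y, Pm (h x) y = (1 / (Fintype.card Ω : ℝ)) * ∑ ω, if h (T ω x) = y then 1 else 0)
    (g : U → ℝ) (x : S) :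
    (Pm.mulVec g) (h x) = (1 / (Fintype.card Ω : ℝ)) * ∑ ω, g (h (T ω x)) := by
  simp only [Matrix.mulVec, dotProduct, hP, mul_assoc, Finset.sum_mul]
  rw [← Finset.mul_sum, Finset.sum_comm]
  simp

theorem cpl_bound (h : S → U) (T : Ω → S → S) (al : S → S → S) (Pm : Matrix U U ℝ)
    (hP : ∀ x y, Pm (h x) y = (1 / (Fintype.card Ω : ℝ)) * ∑ ω, if h (T ω x) = y then 1 else 0)
    (hal : ∀ x y, h (al x y) = h y)
    (f : U → ℝ) (hf0 : ∀ u, 0 ≤ f u) (hf1 : ∀ u, f u ≤ 1) (t : ℕ) :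
    ∀ x y, ((Pm ^ t).mulVec f) (h x) - ((Pm ^ t).mulVec f) (h y) ≤ cpl h T al t x y := by
  induction t with
  | zero =>
    intro x y
    simp only [pow_zero, Matrix.one_mulVec, cpl]
    split_ifs with e
    · rw [e]; simp
    · linarith [hf0 (h y), hf1 (h x)]
  | succ t ih =>
    intro x y
    simp only [cpl]
    split_ifs with e
    · rw [e]; simp
    · rw [← hal x y, pow_succ', ← Matrix.mulVec_mulVec, mulVec_h h T Pm hP, mulVec_h h T Pm hP,
        ← mul_sub, ← Finset.sum_sub_distrib]
      apply mul_le_mul_of_nonneg_left _ (by positivity)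
      exact Finset.sum_le_sum fun ω _ => ih _ _

theorem cpl_sum (h : S → U) (T : Ω → S → S) (al : S → S → S) (Φ : S → S → ℝ)
    (h0 : ∀ x y, 0 ≤ Φ x y)
    (hΦ : ∀ x y, h x ≠ h y →
      (1 / (Fintype.card Ω : ℝ)) * ∑ ω, Φ (T ω x) (T ω (al x y)) ≤ Φ x y - 1) (t : ℕ) :
    ∀ x y, ∑ s ∈ Finset.range t, cpl h T al s x y ≤ Φ x y := by
  induction t with
  | zero => intro x y; simpa using h0 x y
  | succ t ih =>
    intro x y
    by_cases e : h x = h y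
    · have : ∀ s, cpl h T al s x y = 0 := by
        intro s; cases s <;> simp [cpl, e]
      simp [this, h0]
    · rw [Finset.sum_range_succ']
      simp only [cpl, if_neg e]
      rw [← Finset.mul_sum, Finset.sum_comm]
      have := hΦ x y e
      have h2 : (1 / (Fintype.card Ω : ℝ)) * ∑ ω, ∑ s ∈ Finset.range t,
          cpl h T al s (T ω x) (T ω (al x y)) ≤
          (1 / (Fintype.card Ω : ℝ)) * ∑ ω, Φ (T ω x) (T ω (al x y)) := by
        apply mul_le_mul_of_nonneg_left _ (by positivity)
        exact Finset.sum_le_sum fun ω _ => ih _ _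
      linarith

theorem pi_dot (h : S → U) (π : U → ℝ)
    (hπ : ∀ y, π y = ((Finset.univ.filter fun x => h x = y).card : ℝ) / Fintype.card S)
    (g : U → ℝ) : ∑ y, π y * g y = (1 / (Fintype.card S : ℝ)) * ∑ x, g (h x) := by
  have : ∀ y, π y * g y = (1 / (Fintype.card S : ℝ)) * ∑ x, if h x = y then g y else 0 := by
    intro y
    rw [hπ, ← Finset.sum_filter, Finset.sum_const, nsmul_eq_mul]; ring
  simp only [this]
  rw [← Finset.mul_sum, Finset.sum_comm]
  simp

theorem mixing_bound [Nonempty S] [Nonempty Ω] (h : S → U) (hs : Function.Surjective h)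
    (T : Ω → S → S) (hT : ∀ ω, Function.Bijective (T ω)) (Pm : Matrix U U ℝ) (π : U → ℝ)
    (hP : ∀ x y, Pm (h x) y = (1 / (Fintype.card Ω : ℝ)) * ∑ ω, if h (T ω x) = y then 1 else 0)
    (hπ : ∀ y, π y = ((Finset.univ.filter fun x => h x = y).card : ℝ) / Fintype.card S)
    (Φ : S → S → ℝ) (h0 : ∀ x y, 0 ≤ Φ x y)
    (hΦ : ∀ x y, h x ≠ h y → ∃ y', h y' = h y ∧
      (1 / (Fintype.card Ω : ℝ)) * ∑ ω, Φ (T ω x) (T ω y') ≤ Φ x y - 1)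
    (B : ℝ) (hB : ∀ x y, Φ x y ≤ B) (N : ℕ) (hN : 4 * B < N + 1) :
    mixingTime Pm π ≤ N := by
  have hS : (0 : ℝ) < Fintype.card S := by exact_mod_cast Fintype.card_pos
  have hO : (0 : ℝ) < Fintype.card Ω := by exact_mod_cast Fintype.card_pos
  have hex : ∀ x y, ∃ y', h y' = h y ∧ (h x ≠ h y →
      (1 / (Fintype.card Ω : ℝ)) * ∑ ω, Φ (T ω x) (T ω y') ≤ Φ x y - 1) := by
    intro x y
    by_cases e : h x = h y
    · exact ⟨y, rfl, fun h => absurd e h⟩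
    · obtain ⟨y', h1, h2⟩ := hΦ x y e
      exact ⟨y', h1, fun _ => h2⟩
  choose al hal1 hal2 using hex
  -- stationarity
  have hstat1 : ∀ g : U → ℝ, ∑ y, π y * (Pm.mulVec g) y = ∑ y, π y * g y := by
    intro g
    rw [pi_dot h π hπ, pi_dot h π hπ]
    congr 1
    simp only [mulVec_h h T Pm hP]
    rw [← Finset.mul_sum, Finset.sum_comm]
    have : ∀ ω, ∑ x, g (h (T ω x)) = ∑ x, g (h x) := fun ω =>
      (hT ω).sum_comp (fun x => g (h x))
    simp only [this, Finset.sum_const, nsmul_eq_mul, Finset.card_univ]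
    field_simp
  have hstat : ∀ (t : ℕ) (g : U → ℝ), ∑ y, π y * ((Pm ^ t).mulVec g) y = ∑ y, π y * g y := by
    intro t
    induction t with
    | zero => intro g; simp
    | succ t ih => intro g; rw [pow_succ', ← Matrix.mulVec_mulVec, hstat1, ih]
  have hone1 : Pm.mulVec (fun _ => 1) = fun _ => 1 := by
    funext u
    obtain ⟨x, rfl⟩ := hs u
    rw [mulVec_h h T Pm hP]
    simp only [Finset.sum_const, nsmul_eq_mul, Finset.card_univ]
    field_simp
  have hone : ∀ t : ℕ, (Pm ^ t).mulVec (fun _ => 1) = fun _ => 1 := by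
    intro t
    induction t with
    | zero => simp
    | succ t ih => rw [pow_succ, ← Matrix.mulVec_mulVec, hone1, ih]
  have hpi1 : ∑ y, π y = 1 := by
    have := pi_dot h π hπ (fun _ => 1)
    simp only [mul_one, Finset.sum_const, nsmul_eq_mul, Finset.card_univ] at this
    rw [this]; field_simp
  have key : ∀ (x : S) (t : ℕ), (1 / 2 : ℝ) * ∑ y : U, |(Pm ^ t) (h x) y - π y| ≤
      (1 / (Fintype.card S : ℝ)) * ∑ z, cpl h T al t x z := by
    intro x t
    classical
    let f : U → ℝ := fun y => if π y ≤ (Pm ^ t) (h x) y then 1 else 0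
    have habs : ∀ y, (1 / 2 : ℝ) * |(Pm ^ t) (h x) y - π y| =
        ((Pm ^ t) (h x) y * f y - π y * f y) - (1/2) * ((Pm ^ t) (h x) y - π y) := by
      intro y
      simp only [f]
      split_ifs with c
      · rw [abs_of_nonneg (by linarith)]; ring
      · rw [abs_of_neg (by linarith)]; ring
    have hrow : ∑ y, (Pm ^ t) (h x) y = 1 := by
      have := congrFun (hone t) (h x)
      simpa [Matrix.mulVec, dotProduct] using this
    rw [Finset.mul_sum]
    simp only [habs]
    rw [Finset.sum_sub_distrib, ← Finset.mul_sum, Finset.sum_sub_distrib, Finset.sum_sub_distrib,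
      hrow, hpi1, ← hstat t f, pi_dot h π hπ]
    have e1 : ∑ y, (Pm ^ t) (h x) y * f y = (1 / (Fintype.card S : ℝ)) *
        ∑ z : S, ((Pm ^ t).mulVec f) (h x) := by
      simp only [Finset.sum_const, nsmul_eq_mul, Finset.card_univ, Matrix.mulVec, dotProduct]
      field_simp
    rw [e1, ← mul_sub, ← Finset.sum_sub_distrib, sub_self, mul_zero, sub_zero]
    apply mul_le_mul_of_nonneg_left _ (by positivity)
    refine Finset.sum_le_sum fun z _ => cpl_bound h T al Pm hP hal1 f ?_ ?_ t x z
    · intro u; simp only [f]; split_ifs <;> norm_num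
    · intro u; simp only [f]; split_ifs <;> norm_num
  unfold mixingTime
  refine Finset.sup_le fun u _ => ?_
  obtain ⟨x, rfl⟩ := hs u
  by_contra hcon
  push Not at hcon
  have hall : ∀ t ∈ Finset.range (N + 1), (1 / 4 : ℝ) ≤
      (1 / (Fintype.card S : ℝ)) * ∑ z, cpl h T al t x z := by
    intro t ht
    refine le_trans ?_ (key x t)
    by_contra hc
    push Not at hc
    have : sInf {t : ℕ | (1 / 2 : ℝ) * ∑ y : U, |(Pm ^ t) (h x) y - π y| < 1 / 4} ≤ t :=
      Nat.sInf_le hc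
    have := Finset.mem_range.1 ht
    omega
  have hsum := Finset.sum_le_sum hall
  rw [← Finset.mul_sum, Finset.sum_comm] at hsum
  have h3 : ∑ z, ∑ s ∈ Finset.range (N + 1), cpl h T al s x z ≤ ∑ z : S, B :=
    Finset.sum_le_sum fun z _ => (cpl_sum h T al Φ h0 (fun x y => hal2 x y) (N + 1) x z).trans (hB _ _)
  have h4 : (1 / (Fintype.card S : ℝ)) * ∑ z, ∑ s ∈ Finset.range (N + 1), cpl h T al s x z ≤ B := by
    calc _ ≤ (1 / (Fintype.card S : ℝ)) * ∑ z : S, B :=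
          mul_le_mul_of_nonneg_left h3 (by positivity)
      _ = B := by
          simp only [Finset.sum_const, nsmul_eq_mul, Finset.card_univ]
          field_simp
  have h5 := hsum.trans h4
  simp only [Finset.sum_const, nsmul_eq_mul, Finset.card_range] at h5
  push_cast at h5
  linarith

end Abstract

section Core

abbrev Sl (n : ℕ) := Fin (n - 1) × Bool
abbrev Om (n : ℕ) := Fin (n - 2) × Bool × Bool

/-- the slot transposition of an input -/
def swp {n : ℕ} (ω : Om n) : Equiv.Perm (Sl n) :=
  Equiv.swap (idx1 ω.1, ω.2.1) (idx2 ω.1, ω.2.2)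

theorem swp_one {n : ℕ} (u : Fin (n - 2)) (a b : Bool) : swp (u, a, b) (idx1 u, a) = (idx2 u, b) := by
  simp [swp]

theorem swp_two {n : ℕ} (u : Fin (n - 2)) (a b : Bool) : swp (u, a, b) (idx2 u, b) = (idx1 u, a) := by
  simp [swp]

theorem swp_cases {n : ℕ} (u : Fin (n - 2)) (a b : Bool) (s : Sl n) :
    (s = (idx1 u, a) ∧ swp (u, a, b) s = (idx2 u, b)) ∨
    (s = (idx2 u, b) ∧ swp (u, a, b) s = (idx1 u, a)) ∨
    (s ≠ (idx1 u, a) ∧ s ≠ (idx2 u, b) ∧ swp (u, a, b) s = s) := by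
  by_cases h1 : s = (idx1 u, a)
  · left; exact ⟨h1, by rw [h1, swp_one]⟩
  · by_cases h2 : s = (idx2 u, b)
    · right; left; exact ⟨h2, by rw [h2, swp_two]⟩
    · right; right; exact ⟨h1, h2, Equiv.swap_apply_of_ne_of_ne h1 h2⟩

variable {n : ℕ} {Λ : Type*} [Fintype Λ]

open Classical in
noncomputable def stepS (rank : Λ → ℕ) (ω : Om n) (s : Λ → Sl n) : Λ → Sl n :=
  if ∀ l, s l = (idx1 ω.1, ω.2.1) → (ω.1 : ℕ) < rank l then fun l => swp ω (s l) else s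

def vv (M i μ : ℕ) : ℕ := M * (M + 1) * (M + 2) - (i * (i + 1) * (i + 2) + 3 * (μ * (μ + 1)))

def VV (M : ℕ) (rank : Λ → ℕ) (s t : Λ → Sl n) : ℕ :=
  Finset.univ.sup fun l => if (s l).1 = (t l).1 then 0 else
    vv M (rank l) (min ((s l).1 : ℕ) ((t l).1 : ℕ))

theorem VV_symm (M : ℕ) (rank : Λ → ℕ) (s t : Λ → Sl n) : VV M rank s t = VV M rank t s := by
  unfold VV
  congr 1; funext l
  rw [min_comm]
  simp only [eq_comm]

theorem VV_le (M : ℕ) (rank : Λ → ℕ) (s t : Λ → Sl n) : VV M rank s t ≤ M * (M + 1) * (M + 2) := by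
  refine Finset.sup_le fun l _ => ?_
  split_ifs
  · exact Nat.zero_le _
  · exact Nat.sub_le _ _

theorem idx1_val (u : Fin (n - 2)) : ((idx1 u : Fin (n - 1)) : ℕ) = u := rfl
theorem idx2_val (u : Fin (n - 2)) : ((idx2 u : Fin (n - 1)) : ℕ) = u + 1 := rfl

/-- position of a label after a step, lower bound -/
theorem step_pos (rank : Λ → ℕ) (u : Fin (n - 2)) (a b : Bool) (s : Λ → Sl n) (l : Λ) :
    ((s l).1 : ℕ) ≤ ((stepS rank (u, a, b) s l).1 : ℕ) ∨
    (s l = (idx2 u, b) ∧ ((stepS rank (u, a, b) s l).1 : ℕ) + 1 = ((s l).1 : ℕ)) := by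
  unfold stepS
  split_ifs with h
  · rcases swp_cases u a b (s l) with ⟨h1, h2⟩ | ⟨h1, h2⟩ | ⟨_, _, h2⟩
    · left; simp only [h2]; rw [h1]; simp [idx1_val, idx2_val]
    · right; refine ⟨h1, ?_⟩; simp only [h2]; rw [h1]; simp [idx1_val, idx2_val]
    · left; simp only [h2]; exact le_rfl
  · left; exact le_rfl

theorem step_bd (rank : Λ → ℕ) (ω : Om n) (s : Λ → Sl n) (hb : ∀ l, ((s l).1 : ℕ) ≤ rank l) (l : Λ) :
    ((stepS rank ω s l).1 : ℕ) ≤ rank l := by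
  obtain ⟨u, a, b⟩ := ω
  unfold stepS
  split_ifs with h
  · rcases swp_cases u a b (s l) with ⟨h1, h2⟩ | ⟨h1, h2⟩ | ⟨_, _, h2⟩
    · simp only [h2, idx2_val]; exact h l h1
    · simp only [h2, idx1_val]; have := hb l; rw [h1] at this; simp only [idx2_val] at this; omega
    · simp only [h2]; exact hb l
  · exact hb l

theorem step_align (rank : Λ → ℕ) (ω : Om n) (s t : Λ → Sl n)
    (hs : ∀ l, ((s l).1 : ℕ) ≤ rank l) (ht : ∀ l, ((t l).1 : ℕ) ≤ rank l) (i : ℕ)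
    (hal : ∀ l, rank l < i → s l = t l) (l : Λ) (hl : rank l < i) :
    stepS rank ω s l = stepS rank ω t l := by
  obtain ⟨u, a, b⟩ := ω
  by_cases hu : (u : ℕ) < i
  · have : (∀ l, s l = (idx1 u, a) → (u : ℕ) < rank l) ↔ (∀ l, t l = (idx1 u, a) → (u : ℕ) < rank l) := by
      constructor
      · intro h l' hl'
        by_contra hc
        have := h l' (by rw [hal l' (by omega)]; exact hl')
        omega
      · intro h l' hl'
        by_contra hc
        have := h l' (by rw [← hal l' (by omega)]; exact hl')
        omega
    unfold stepS
    simp only [this]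
    split_ifs
    · simp only [hal l hl]
    · exact hal l hl
  · have key : ∀ s : Λ → Sl n, (∀ l, ((s l).1 : ℕ) ≤ rank l) → stepS rank (u, a, b) s l = s l := by
      intro s hs
      unfold stepS
      split_ifs
      · have := hs l
        rcases swp_cases u a b (s l) with ⟨h1, h2⟩ | ⟨h1, h2⟩ | ⟨_, _, h2⟩
        · rw [h1] at this; simp only [idx1_val] at this; omega
        · rw [h1] at this; simp only [idx2_val] at this; omega
        · exact h2
      · rfl
    rw [key s hs, key t ht, hal l hl]

theorem vv_mono_rank (M i j μ : ℕ) (h : i < j) :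
    vv M j μ ≤ M * (M + 1) * (M + 2) - (i + 1) * (i + 2) * (i + 3) := by
  unfold vv
  apply Nat.sub_le_sub_left
  have : (i + 1) * (i + 2) * (i + 3) ≤ j * (j + 1) * (j + 2) := by
    exact Nat.mul_le_mul (Nat.mul_le_mul (by omega) (by omega)) (by omega)
  omega

/-- upper bound on potential -/
theorem VV_bound (M : ℕ) (rank : Λ → ℕ) (hr : Function.Injective rank) (s t : Λ → Sl n) (l0 : Λ)
    (hal : ∀ l, rank l < rank l0 → s l = t l) (K : ℕ)
    (h1 : M * (M + 1) * (M + 2) - (rank l0 + 1) * (rank l0 + 2) * (rank l0 + 3) ≤ K)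
    (h2 : (s l0).1 ≠ (t l0).1 → vv M (rank l0) (min ((s l0).1 : ℕ) ((t l0).1 : ℕ)) ≤ K) :
    VV M rank s t ≤ K := by
  refine Finset.sup_le fun l _ => ?_
  split_ifs with h
  · exact Nat.zero_le _
  · rcases lt_trichotomy (rank l) (rank l0) with h3 | h3 | h3
    · exact absurd (by rw [hal l h3]) h
    · have := hr h3; subst this; exact h2 h
    · exact (vv_mono_rank M _ _ _ h3).trans h1

theorem drift_one (M : ℕ) (rank : Λ → ℕ) (hr : Function.Injective rank) (hM : ∀ l, rank l < M)
    (s t : Λ → Sl n) (hsi : Function.Injective s)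
    (hs : ∀ l, ((s l).1 : ℕ) ≤ rank l) (ht : ∀ l, ((t l).1 : ℕ) ≤ rank l) (l0 : Λ)
    (hal : ∀ l, rank l < rank l0 → s l = t l) (hpq : ((s l0).1 : ℕ) < ((t l0).1 : ℕ))
    (u : Fin (n - 2)) (a b : Bool) :
    (VV M rank (stepS rank (u, a, b) s) (stepS rank (u, a, b) t) : ℝ) ≤ VV M rank s t
      - (if (u : ℕ) = (s l0).1 ∧ a = (s l0).2 then
          (if ((t l0).1 : ℕ) = (s l0).1 + 1 then (if b = (t l0).2 then 0 else 12 * ((s l0).1 : ℝ) + 12)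
            else 6 * ((s l0).1 : ℝ) + 6) else 0)
      + (if (u : ℕ) + 1 = (s l0).1 ∧ b = (s l0).2 then 6 * ((s l0).1 : ℝ) else 0) := by
  set s' := stepS rank (u, a, b) s with hs'
  set t' := stepS rank (u, a, b) t with ht'
  set p := ((s l0).1 : ℕ) with hp
  set q := ((t l0).1 : ℕ) with hq
  set i := rank l0 with hi
  have hal' : ∀ l, rank l < rank l0 → s' l = t' l := fun l hl =>
    step_align rank _ s t hs ht _ hal l hl
  have hqi : q ≤ i := ht l0
  have hiM : i < M := hM l0
  set p' := ((s' l0).1 : ℕ) with hp'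
  set q' := ((t' l0).1 : ℕ) with hq'
  have hp'i : p' ≤ i := step_bd rank _ s hs l0
  have hq'i : q' ≤ i := step_bd rank _ t ht l0
  have hV : vv M i p ≤ VV M rank s t := by
    have := Finset.le_sup (f := fun l => if (s l).1 = (t l).1 then 0 else
      vv M (rank l) (min ((s l).1 : ℕ) ((t l).1 : ℕ))) (Finset.mem_univ l0)
    have hne : (s l0).1 ≠ (t l0).1 := fun h => by rw [hp, hq, h] at hpq; omega
    simp only [if_neg hne] at this
    rwa [min_eq_left hpq.le] at this
  have htot : (i + 1) * (i + 2) * (i + 3) ≤ M * (M + 1) * (M + 2) := by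
    exact Nat.mul_le_mul (Nat.mul_le_mul (by omega) (by omega)) (by omega)
  have hloc : ∀ μ, μ ≤ i + 1 → i * (i + 1) * (i + 2) + 3 * (μ * (μ + 1)) ≤
      (i + 1) * (i + 2) * (i + 3) := by
    intro μ hμ
    have : μ * (μ + 1) ≤ (i + 1) * (i + 2) := Nat.mul_le_mul (by omega) (by omega)
    nlinarith
  have hVr : ((M * (M + 1) * (M + 2) : ℕ) : ℝ) - (i * (i + 1) * (i + 2) + 3 * (p * (p + 1))) ≤
      VV M rank s t := by
    have h1 := hloc p (by omega)
    have h2 : M * (M + 1) * (M + 2) ≤ VV M rank s t + (i * (i + 1) * (i + 2) + 3 * (p * (p + 1))) := by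
      unfold vv at hV; omega
    have h3 : ((M * (M + 1) * (M + 2) : ℕ) : ℝ) ≤
      (VV M rank s t + (i * (i + 1) * (i + 2) + 3 * (p * (p + 1))) : ℕ) := by exact_mod_cast h2
    push_cast at h3 ⊢
    linarith
  -- bound by any μ below min
  have hA : ∀ μ : ℕ, μ ≤ p' → μ ≤ q' → (VV M rank s' t' : ℝ) ≤
      ((M * (M + 1) * (M + 2) : ℕ) : ℝ) - (i * (i + 1) * (i + 2) + 3 * (μ * (μ + 1))) := by
    intro μ h1 h2
    have h3 := hloc μ (by omega)
    have h4 : VV M rank s' t' ≤ M * (M + 1) * (M + 2) - (i * (i + 1) * (i + 2) + 3 * (μ * (μ + 1))) := by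
      apply VV_bound M rank hr s' t' l0 hal'
      · exact Nat.sub_le_sub_left h3 _
      · intro _
        unfold vv
        apply Nat.sub_le_sub_left
        have : μ ≤ min p' q' := le_min h1 h2
        have : μ * (μ + 1) ≤ min p' q' * (min p' q' + 1) := Nat.mul_le_mul (by omega) (by omega)
        change i * (i + 1) * (i + 2) + 3 * (μ * (μ + 1)) ≤
          i * (i + 1) * (i + 2) + 3 * (min p' q' * (min p' q' + 1))
        omega
    have h5 : VV M rank s' t' + (i * (i + 1) * (i + 2) + 3 * (μ * (μ + 1))) ≤ M * (M + 1) * (M + 2) := by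
      omega
    have h6 : ((VV M rank s' t' + (i * (i + 1) * (i + 2) + 3 * (μ * (μ + 1))) : ℕ) : ℝ) ≤
      ((M * (M + 1) * (M + 2) : ℕ) : ℝ) := by exact_mod_cast h5
    push_cast at h6 ⊢
    linarith
  have hB : p' = q' → (VV M rank s' t' : ℝ) ≤
      ((M * (M + 1) * (M + 2) : ℕ) : ℝ) - ((i + 1) * (i + 2) * (i + 3)) := by
    intro h1
    have h4 : VV M rank s' t' ≤ M * (M + 1) * (M + 2) - (i + 1) * (i + 2) * (i + 3) := by
      apply VV_bound M rank hr s' t' l0 hal'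
      · exact le_rfl
      · intro h; exact absurd (Fin.ext h1) h
    have h5 : VV M rank s' t' + (i + 1) * (i + 2) * (i + 3) ≤ M * (M + 1) * (M + 2) := by
      omega
    have h6 : ((VV M rank s' t' + (i + 1) * (i + 2) * (i + 3) : ℕ) : ℝ) ≤
      ((M * (M + 1) * (M + 2) : ℕ) : ℝ) := by exact_mod_cast h5
    push_cast at h6 ⊢
    linarith
  have hsp := step_pos rank u a b s l0
  have htp := step_pos rank u a b t l0
  simp only [← hs', ← ht', ← hp, ← hq, ← hp', ← hq'] at hsp htp
  by_cases c1 : (u : ℕ) = p ∧ a = (s l0).2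
  · have c4 : ¬ ((u : ℕ) + 1 = p ∧ b = (s l0).2) := by omega
    rw [if_pos c1, if_neg c4, add_zero]
    have hsl : s l0 = (idx1 u, a) := Prod.ext (Fin.ext (by simp only [idx1_val]; omega)) c1.2.symm
    have hmv : s' l0 = (idx2 u, b) := by
      have : ∀ l, s l = (idx1 u, a) → (u : ℕ) < rank l := by
        intro l hl
        have : l = l0 := hsi (hl.trans hsl.symm)
        subst this
        omega
      rw [hs']
      unfold stepS
      simp only [if_pos this, hsl, swp_one]
    have hp'1 : p' = p + 1 := by rw [hp', hmv, idx2_val]; omega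
    by_cases c2 : q = p + 1
    · rw [if_pos c2]
      by_cases c3 : b = (t l0).2
      · rw [if_pos c3]
        have := hA p (by omega) (by omega)
        linarith
      · rw [if_neg c3]
        have hq'1 : q' = q := by
          have h1 : t l0 ≠ (idx1 u, a) := by
            intro h; rw [h] at hq; simp only [idx1_val] at hq; omega
          have h2 : t l0 ≠ (idx2 u, b) := by
            intro h; rw [h] at c3; exact c3 rfl
          rw [hq', ht', hq]
          unfold stepS
          split_ifs
          · rcases swp_cases u a b (t l0) with h | h | h
            · exact absurd h.1 h1
            · exact absurd h.1 h2
            · simp only [h.2.2]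
          · rfl
        have h7 := hB (by omega)
        have h8 : (p : ℝ) + 1 ≤ i := by exact_mod_cast (by omega : p + 1 ≤ i)
        have h9 : (0 : ℝ) ≤ p := by positivity
        nlinarith
    · rw [if_neg c2]
      have := hA (p + 1) (by omega) (by omega)
      push_cast at this hVr ⊢
      nlinarith
  · rw [if_neg c1]
    by_cases c2 : (u : ℕ) + 1 = p ∧ b = (s l0).2
    · rw [if_pos c2]
      have := hA (p - 1) (by omega) (by omega)
      have e : ((p - 1 : ℕ) : ℝ) = p - 1 := by
        rw [Nat.cast_sub (by omega)]; simp
      rw [e] at this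
      nlinarith
    · rw [if_neg c2]
      have hpp : p ≤ p' := by
        rcases hsp with h | h
        · exact h
        · exfalso; apply c2
          have := h.1
          constructor
          · rw [hp, this, idx2_val]
          · rw [this]
      have := hA p (by omega) (by omega)
      linarith

theorem drift (M : ℕ) (rank : Λ → ℕ) (hr : Function.Injective rank) (hM : ∀ l, rank l < M)
    (s t : Λ → Sl n) (hsi : Function.Injective s)
    (hs : ∀ l, ((s l).1 : ℕ) ≤ rank l) (ht : ∀ l, ((t l).1 : ℕ) ≤ rank l) (l0 : Λ)
    (hal : ∀ l, rank l < rank l0 → s l = t l) (hpq : ((s l0).1 : ℕ) < ((t l0).1 : ℕ)) :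
    ∑ ω : Om n, (VV M rank (stepS rank ω s) (stepS rank ω t) : ℝ) ≤
      4 * ((n - 2 : ℕ) : ℝ) * VV M rank s t - 12 := by
  have hlt : ((s l0).1 : ℕ) < n - 2 := by have := (t l0).1.isLt; omega
  set p := ((s l0).1 : ℕ) with hp
  have h1 := Finset.sum_le_sum (s := Finset.univ) fun (ω : Om n) _ =>
    drift_one M rank hr hM s t hsi hs ht l0 hal hpq ω.1 ω.2.1 ω.2.2
  refine h1.trans ?_
  rw [Finset.sum_add_distrib, Finset.sum_sub_distrib]
  simp only [Finset.sum_const, Finset.card_univ, Fintype.card_prod, Fintype.card_fin,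
    Fintype.card_bool, nsmul_eq_mul, Fintype.sum_prod_type, ← hp]
  have e2 : ∑ u : Fin (n - 2), ∑ a : Bool, ∑ b : Bool,
      (if (u : ℕ) + 1 = p ∧ b = (s l0).2 then 6 * (p : ℝ) else 0) ≤ 12 * (p : ℝ) := by
    have : ∀ u : Fin (n - 2), ∑ a : Bool, ∑ b : Bool,
      (if (u : ℕ) + 1 = p ∧ b = (s l0).2 then 6 * (p : ℝ) else 0) =
        if (u : ℕ) + 1 = p then 12 * (p : ℝ) else 0 := by
      intro u
      by_cases h : (u : ℕ) + 1 = p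
      · simp [h]; ring
      · simp [h]
    simp only [this]
    by_cases hp0 : p = 0
    · simp [hp0]
    · have : ∀ u : Fin (n - 2), ((u : ℕ) + 1 = p) ↔ u = ⟨p - 1, by omega⟩ := by
        intro u; rw [Fin.ext_iff]; simp only; omega
      simp [this]
  have e1 : ∀ f : Bool → ℝ, ∑ u : Fin (n - 2), ∑ a : Bool, ∑ b : Bool,
      (if (u : ℕ) = p ∧ a = (s l0).2 then f b else 0) = ∑ b, f b := by
    intro f
    have : ∀ u : Fin (n - 2), ∑ a : Bool, ∑ b : Bool,
      (if (u : ℕ) = p ∧ a = (s l0).2 then f b else 0) =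
        if u = ⟨p, hlt⟩ then ∑ b, f b else 0 := by
      intro u
      by_cases h : (u : ℕ) = p
      · have h' : u = ⟨p, hlt⟩ := Fin.ext h
        rw [if_pos h']
        cases (s l0).2 <;> simp [h]
      · have h' : u ≠ ⟨p, hlt⟩ := fun e => h (by rw [e])
        simp [h, h']
    simp only [this, Finset.sum_ite_eq', Finset.mem_univ, if_true]
  rw [e1 (fun b => if ((t l0).1 : ℕ) = p + 1 then
      (if b = (t l0).2 then 0 else 12 * (p : ℝ) + 12) else 6 * (p : ℝ) + 6)]
  have e3 : (12 : ℝ) * p + 12 ≤ ∑ b : Bool, (if ((t l0).1 : ℕ) = p + 1 then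
      (if b = (t l0).2 then 0 else 12 * (p : ℝ) + 12) else 6 * (p : ℝ) + 6) := by
    split_ifs
    · cases (t l0).2 <;> simp
    · simp; linarith
  push_cast
  linarith

end Core

section Content

variable {n : ℕ} {Λ Lab : Type*} [Fintype Λ] [Fintype Lab] [DecidableEq Lab]

def Val (ι : Λ → Lab) (rank : Λ → ℕ) (c : Sl n → Lab) : Prop :=
  (∀ l, ∃! s, c s = ι l) ∧ ∀ l s, c s = ι l → (s.1 : ℕ) ≤ rank l

noncomputable instance (ι : Λ → Lab) (rank : Λ → ℕ) :
    DecidablePred (Val (n := n) ι rank) := Classical.decPred _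

abbrev St (n : ℕ) {Λ Lab : Type*} (ι : Λ → Lab) (rank : Λ → ℕ) := {c : Sl n → Lab // Val ι rank c}

variable {ι : Λ → Lab} {rank : Λ → ℕ}

noncomputable def sig (c : St n ι rank) (l : Λ) : Sl n := (c.2.1 l).choose

theorem sig_iff (c : St n ι rank) (l : Λ) (s : Sl n) : c.1 s = ι l ↔ s = sig c l := by
  have h := (c.2.1 l).choose_spec
  constructor
  · exact fun hs => h.2 s hs
  · rintro rfl; exact h.1

theorem sig_inj (hι : Function.Injective ι) (c : St n ι rank) : Function.Injective (sig c) := by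
  intro l l' e
  apply hι
  rw [← (sig_iff c l _).2 rfl, ← (sig_iff c l' _).2 rfl, e]

theorem sig_bd (c : St n ι rank) (l : Λ) : ((sig c l).1 : ℕ) ≤ rank l :=
  c.2.2 l _ ((sig_iff c l _).2 rfl)

/-- precomposition with a permutation -/
theorem perm_iff (c : St n ι rank) (e : Equiv.Perm (Sl n)) (l : Λ) (s : Sl n) :
    c.1 (e s) = ι l ↔ s = e.symm (sig c l) := by
  rw [sig_iff, Equiv.eq_symm_apply]

theorem perm_val (c : St n ι rank) (e : Equiv.Perm (Sl n)) :
    Val ι rank (fun s => c.1 (e s)) ↔ ∀ l, ((e.symm (sig c l)).1 : ℕ) ≤ rank l := by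
  unfold Val
  simp only [perm_iff]
  constructor
  · intro h l; exact h.2 l _ rfl
  · intro h
    refine ⟨fun l => ⟨_, rfl, fun _ h => h⟩, ?_⟩
    rintro l s rfl; exact h l

noncomputable def TT (ω : Om n) (c : St n ι rank) : St n ι rank :=
  if h : Val ι rank (fun s => c.1 (swp ω s)) then ⟨fun s => c.1 (swp ω s), h⟩ else c

theorem swp_swp (ω : Om n) (s : Sl n) : swp ω (swp ω s) = s := by
  simp [swp]

theorem swp_symm (ω : Om n) : (swp ω).symm = swp ω := by
  simp [swp]

theorem TT_inv (ω : Om n) : Function.Involutive (TT (ι := ι) (rank := rank) ω) := by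
  intro c
  by_cases h : Val ι rank (fun s => c.1 (swp ω s))
  · have : TT ω c = ⟨fun s => c.1 (swp ω s), h⟩ := by unfold TT; rw [dif_pos h]
    rw [this]
    unfold TT
    simp only [swp_swp]
    rw [dif_pos c.2]
  · have : TT ω c = c := by unfold TT; rw [dif_neg h]
    rw [this, this]

theorem sig_eq_of (c d : St n ι rank) (e : Equiv.Perm (Sl n)) (h : ∀ s, d.1 s = c.1 (e s)) (l : Λ) :
    sig d l = e.symm (sig c l) := by
  rw [← perm_iff, ← h, sig_iff]

theorem sig_TT (ω : Om n) (c : St n ι rank) : sig (TT ω c) = stepS rank ω (sig c) := by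
  have key : Val ι rank (fun s => c.1 (swp ω s)) ↔
      ∀ l, sig c l = (idx1 ω.1, ω.2.1) → (ω.1 : ℕ) < rank l := by
    rw [perm_val, swp_symm]
    obtain ⟨u, a, b⟩ := ω
    refine forall_congr' fun l => ?_
    have hb := sig_bd c l
    rcases swp_cases u a b (sig c l) with ⟨h1, h2⟩ | ⟨h1, h2⟩ | ⟨h0, _, h2⟩
    · rw [h2, h1]; simp only [idx2_val, true_imp_iff]; rfl
    · rw [h2]; rw [h1] at hb ⊢; simp only [idx2_val, idx1_val] at hb ⊢
      constructor
      · intro _ h; have := congrArg (fun z => (z.1 : ℕ)) h; simp [idx1_val, idx2_val] at this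
      · intro _; omega
    · rw [h2]; simp only [h0, false_imp_iff, iff_true]; exact hb
  by_cases h : Val ι rank (fun s => c.1 (swp ω s))
  · have e : TT ω c = ⟨fun s => c.1 (swp ω s), h⟩ := by unfold TT; rw [dif_pos h]
    funext l
    unfold stepS
    rw [if_pos (key.1 h), sig_eq_of c (TT ω c) (swp ω) (by rw [e]; intro s; rfl) l, swp_symm]
  · have e : TT ω c = c := by unfold TT; rw [dif_neg h]
    rw [e]
    unfold stepS
    rw [if_neg (fun h' => h (key.2 h'))]

/-- flipping slots -/
def flp (g : Fin (n - 1) → Bool) : Equiv.Perm (Sl n) where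
  toFun s := (s.1, xor s.2 (g s.1))
  invFun s := (s.1, xor s.2 (g s.1))
  left_inv s := by simp
  right_inv s := by simp

def flipSt (g : Fin (n - 1) → Bool) (c : St n ι rank) : St n ι rank :=
  ⟨fun s => c.1 (flp g s), (perm_val c (flp g)).2 fun l => sig_bd c l⟩

theorem sig_flip (g : Fin (n - 1) → Bool) (c : St n ι rank) (l : Λ) :
    sig (flipSt g c) l = ((sig c l).1, xor (sig c l).2 (g (sig c l).1)) := by
  rw [sig_eq_of c (flipSt g c) (flp g) (fun s => rfl)]; rfl

open Classical in
theorem exists_align (hι : Function.Injective ι) (x y : St n ι rank) (D : Set Λ)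
    (hD : ∀ l ∈ D, (sig x l).1 = (sig y l).1) :
    ∃ g, ∀ l ∈ D, sig (flipSt g y) l = sig x l := by
  refine ⟨fun r => decide (∃ l ∈ D, (sig x l).1 = r ∧ (sig x l).2 ≠ (sig y l).2), ?_⟩
  intro l hl
  rw [sig_flip]
  have h1 := hD l hl
  refine Prod.ext h1.symm ?_
  simp only
  by_cases h : ∃ l' ∈ D, (sig x l').1 = (sig y l).1 ∧ (sig x l').2 ≠ (sig y l').2
  · rw [decide_eq_true h]
    obtain ⟨l', hl', h2, h3⟩ := h
    by_cases e : l' = l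
    · subst e
      revert h3
      cases (sig x l').2 <;> cases (sig y l').2 <;> simp
    · have hx : (sig x l').2 ≠ (sig x l).2 := fun h4 =>
        e (sig_inj hι x (Prod.ext (h2.trans h1.symm) h4))
      have hy : (sig y l').2 ≠ (sig y l).2 := fun h4 =>
        e (sig_inj hι y (Prod.ext ((hD l' hl').symm.trans h2) h4))
      revert h3 hx hy
      cases (sig x l').2 <;> cases (sig y l').2 <;> cases (sig x l).2 <;> cases (sig y l).2 <;> simp
  · rw [decide_eq_false h]
    simp only [Bool.xor_false]
    by_contra hc
    exact h ⟨l, hl, h1, fun h => hc h.symm⟩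

theorem ext_sig (hdet : ∀ a b : Lab, a ∉ Set.range ι → b ∉ Set.range ι → a = b)
    (x y : St n ι rank) (h : ∀ l, sig x l = sig y l) : x = y := by
  apply Subtype.ext; funext s
  by_cases h1 : x.1 s ∈ Set.range ι
  · obtain ⟨l, hl⟩ := h1
    rw [← hl, eq_comm, sig_iff, ← h, ← sig_iff, hl]
  · by_cases h2 : y.1 s ∈ Set.range ι
    · obtain ⟨l, hl⟩ := h2
      rw [← hl, sig_iff, h, ← sig_iff, hl]
    · exact hdet _ _ h1 h2

theorem gen_bound {U : Type*} [Fintype U] [DecidableEq U] (hn : 4 ≤ n)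
    (hι : Function.Injective ι) (hr : Function.Injective rank) (M : ℕ) (hM : ∀ l, rank l < M)
    (hdet : ∀ a b : Lab, a ∉ Set.range ι → b ∉ Set.range ι → a = b)
    (h : St n ι rank → U) (hs : Function.Surjective h)
    (hfl : ∀ g c, h (flipSt g c) = h c) (Pm : Matrix U U ℝ) (π : U → ℝ)
    (hP : ∀ x y, Pm (h x) y = (1 / (4 * ((n : ℝ) - 2))) * ∑ ω, if h (TT ω x) = y then 1 else 0)
    (hπ : ∀ y, π y = ((Finset.univ.filter fun x => h x = y).card : ℝ) / Fintype.card (St n ι rank))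
    (N : ℕ) (hN : 4 * (((n : ℝ) - 2) / 3 * (M * (M + 1) * (M + 2))) < N + 1) :
    mixingTime Pm π ≤ N := by
  classical
  rcases isEmpty_or_nonempty (St n ι rank) with hE | hE
  · have : IsEmpty U := ⟨fun u => by obtain ⟨x, _⟩ := hs u; exact hE.elim x⟩
    unfold mixingTime
    simp
  have hn2 : (0 : ℝ) < (n : ℝ) - 2 := by
    have : (4 : ℝ) ≤ n := by exact_mod_cast hn
    linarith
  have hcast : ((n - 2 : ℕ) : ℝ) = (n : ℝ) - 2 := by rw [Nat.cast_sub (by omega)]; simp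
  have hcard : (Fintype.card (Om n) : ℝ) = 4 * ((n : ℝ) - 2) := by
    simp only [Fintype.card_prod, Fintype.card_fin, Fintype.card_bool]
    push_cast
    rw [hcast]; ring
  haveI : Nonempty (Om n) := ⟨(⟨0, by omega⟩, true, true)⟩
  refine mixing_bound h hs TT (fun ω => (TT_inv ω).bijective) Pm π ?_ hπ
    (fun x y => ((n : ℝ) - 2) / 3 * (VV M rank (sig x) (sig y) : ℝ)) ?_ ?_ 
    (((n : ℝ) - 2) / 3 * (M * (M + 1) * (M + 2))) ?_ N hN
  · intro x y; rw [hcard, hP]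
  · intro x y; positivity
  · intro x y hxy
    have hex : ∃ i, ∃ l, rank l = i ∧ (sig x l).1 ≠ (sig y l).1 := by
      by_contra hc
      push Not at hc
      obtain ⟨g, hg⟩ := exists_align hι x y Set.univ (fun l _ => hc _ l rfl)
      have : flipSt g y = x := ext_sig hdet _ _ fun l => hg l trivial
      exact hxy (by rw [← this, hfl])
    obtain ⟨l0, hl0, hne⟩ := Nat.find_spec hex
    have hmin : ∀ l, rank l < rank l0 → (sig x l).1 = (sig y l).1 := by
      intro l hl
      by_contra hc
      exact Nat.find_min hex (m := rank l) (by rw [← hl0]; exact hl) ⟨l, rfl, hc⟩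
    obtain ⟨g, hg⟩ := exists_align hι x y {l | rank l < rank l0} hmin
    refine ⟨flipSt g y, hfl _ _, ?_⟩
    have hVy : VV M rank (sig x) (sig y) = VV M rank (sig x) (sig (flipSt g y)) := by
      unfold VV
      simp only [sig_flip]
    simp only [sig_TT]
    rw [hVy, hcard]
    set y' := flipSt g y
    have hy'1 : (sig y' l0).1 = (sig y l0).1 := by rw [sig_flip]
    have main : ∑ ω : Om n, (VV M rank (stepS rank ω (sig x)) (stepS rank ω (sig y')) : ℝ) ≤
        4 * ((n : ℝ) - 2) * VV M rank (sig x) (sig y') - 12 := by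
      rw [← hcast]
      rcases lt_or_gt_of_ne (fun e => hne (Fin.ext e) : ((sig x l0).1 : ℕ) ≠ ((sig y l0).1 : ℕ)) with hlt | hlt
      · exact drift M rank hr hM _ _ (sig_inj hι x) (sig_bd x) (sig_bd y') l0
          (fun l hl => (hg l hl).symm) (by rw [hy'1]; exact hlt)
      · have := drift M rank hr hM _ _ (sig_inj hι y') (sig_bd y') (sig_bd x) l0
          (fun l hl => (hg l hl)) (by rw [hy'1]; exact hlt)
        rw [VV_symm M rank (sig x) (sig y')]
        simp only [VV_symm M rank (stepS rank _ (sig x)) _]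
        exact this
    rw [← Finset.mul_sum]
    have e : 1 / (4 * ((n : ℝ) - 2)) * (((n : ℝ) - 2) / 3 *
        ∑ ω : Om n, (VV M rank (stepS rank ω (sig x)) (stepS rank ω (sig y')) : ℝ)) =
        (1 / 12) * ∑ ω : Om n, (VV M rank (stepS rank ω (sig x)) (stepS rank ω (sig y')) : ℝ) := by
      field_simp; ring
    rw [e]
    linarith
  · intro x y
    apply mul_le_mul_of_nonneg_left _ (by positivity)
    exact_mod_cast VV_le M rank (sig x) (sig y)

end Content

section PairUp

/-- number of ordered representatives in a fiber -/
theorem fiber_card {n : ℕ} {Λ Lab X : Type*} [Fintype Lab] [DecidableEq Lab] [DecidableEq X]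
    {ι : Λ → Lab} {rank : Λ → ℕ} (mk : Lab → Lab → X) (Vd : (Fin (n - 1) → X) → Prop)
    (hv : ∀ c : Sl n → Lab, Val ι rank c ↔
      Vd (fun k => mk (c (k.rev, false)) (c (k.rev, true)))) (y : Fin (n - 1) → X) (hy : Vd y) :
    (Finset.univ.filter fun x : St n ι rank =>
      (fun k => mk (x.1 (k.rev, false)) (x.1 (k.rev, true))) = y).card =
      ∏ k, (Finset.univ.filter fun q : Lab × Lab => mk q.1 q.2 = y k).card := by
  rw [← Fintype.card_piFinset]
  refine Finset.card_nbij (fun x k => (x.1 (k.rev, false), x.1 (k.rev, true))) ?_ ?_ ?_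
  · intro x hx
    replace hx := (Finset.mem_filter.1 (Finset.mem_coe.1 hx)).2
    simp only [Finset.mem_coe, Fintype.mem_piFinset, Finset.mem_filter, Finset.mem_univ, true_and]
    exact fun k => congrFun hx k
  · intro x _ x' _ h
    apply Subtype.ext
    funext ⟨r, b⟩
    have := congrFun h r.rev
    simp only [Fin.rev_rev, Prod.mk.injEq] at this
    cases b
    · exact this.1
    · exact this.2
  · intro d hd
    simp only [Finset.mem_coe, Fintype.mem_piFinset, Finset.mem_filter, Finset.mem_univ, true_and] at hd
    have e : (fun k : Fin (n - 1) => mk (d k).1 (d k).2) = y := funext hd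
    refine ⟨⟨fun s => if s.2 then (d s.1.rev).2 else (d s.1.rev).1, ?_⟩, ?_, ?_⟩
    · rw [hv]; simp only [Fin.rev_rev]; simpa [e] using hy
    · simp only [Finset.coe_filter, Finset.mem_univ, true_and, Set.mem_ofPred_eq, Fin.rev_rev]
      simpa using e
    · funext k; simp

theorem ms_pairs {Lab : Type*} [Fintype Lab] [DecidableEq Lab] (a b : Lab) :
    (Finset.univ.filter fun q : Lab × Lab => ({q.1, q.2} : Multiset Lab) = {a, b}).card =
      if a = b then 1 else 2 := by
  have : (Finset.univ.filter fun q : Lab × Lab => ({q.1, q.2} : Multiset Lab) = {a, b}) =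
      {(a, b), (b, a)} := by
    ext ⟨c, d⟩
    simp only [Finset.mem_filter, Finset.mem_univ, true_and, Finset.mem_insert,
      Finset.mem_singleton, Prod.mk.injEq]
    constructor
    · intro h
      have h1 : c ∈ ({a, b} : Multiset Lab) := by rw [← h]; simp
      simp only [Multiset.insert_eq_cons, Multiset.mem_cons, Multiset.mem_singleton] at h1
      rcases h1 with rfl | rfl
      · left
        simpa [Multiset.insert_eq_cons] using h
      · right
        rw [Multiset.pair_comm a c] at h
        simpa [Multiset.insert_eq_cons] using h
    · rintro (⟨rfl, rfl⟩ | ⟨rfl, rfl⟩)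
      · rfl
      · exact Multiset.pair_comm _ _
  rw [this]
  split_ifs with h
  · subst h; simp
  · rw [Finset.card_pair]; intro e; exact h (Prod.ext_iff.1 e).1

theorem fs_pairs {Lab : Type*} [Fintype Lab] [DecidableEq Lab] (P : Finset Lab) (hP : P.card = 2) :
    (Finset.univ.filter fun q : Lab × Lab => ({q.1, q.2} : Finset Lab) = P).card = 2 := by
  obtain ⟨a, b, hab, rfl⟩ := Finset.card_eq_two.1 hP
  have : (Finset.univ.filter fun q : Lab × Lab => ({q.1, q.2} : Finset Lab) = {a, b}) =
      {(a, b), (b, a)} := by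
    ext ⟨c, d⟩
    simp only [Finset.mem_filter, Finset.mem_univ, true_and, Finset.mem_insert,
      Finset.mem_singleton, Prod.mk.injEq]
    constructor
    · intro h
      have h1 : c ∈ ({a, b} : Finset Lab) := by rw [← h]; simp
      have h2 : d ∈ ({a, b} : Finset Lab) := by rw [← h]; simp
      have h3 : a ∈ ({c, d} : Finset Lab) := by rw [h]; simp
      have h4 : b ∈ ({c, d} : Finset Lab) := by rw [h]; simp
      simp only [Finset.mem_insert, Finset.mem_singleton] at h1 h2 h3 h4
      grind
    · rintro (⟨rfl, rfl⟩ | ⟨rfl, rfl⟩)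
      · rfl
      · exact Finset.pair_comm _ _
  rw [this, Finset.card_pair]
  intro e; exact hab (Prod.ext_iff.1 e).1

theorem rev_idx1 {n : ℕ} (u : Fin (n - 2)) : (idx1 u : Fin (n - 1)).rev = idx2 u.rev := by
  apply Fin.ext; simp only [Fin.val_rev, idx1_val, idx2_val]; omega

theorem rev_idx2 {n : ℕ} (u : Fin (n - 2)) : (idx2 u : Fin (n - 1)).rev = idx1 u.rev := by
  apply Fin.ext; simp only [Fin.val_rev, idx1_val, idx2_val]; omega

theorem idx_ne {n : ℕ} (u : Fin (n - 2)) : (idx1 u : Fin (n - 1)) ≠ idx2 u := by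
  intro h; have := congrArg Fin.val h; simp [idx1_val, idx2_val] at this

/-- injective placements -/
abbrev Pos (m R : ℕ) := {f : Fin m → Fin R × Bool // Function.Injective f ∧ ∀ i, ((f i).1 : ℕ) ≤ i}

theorem pos_ext_card (m R : ℕ) (hm : m < R) (f : Pos m R) :
    Fintype.card {s : Fin R × Bool // (s.1 : ℕ) ≤ m ∧ s ∉ Set.range f.1} = m + 2 := by
  classical
  rw [Fintype.card_subtype]
  have h1 : (Finset.univ.filter fun s : Fin R × Bool => (s.1 : ℕ) ≤ m ∧ s ∉ Set.range f.1) =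
      (Finset.Iic (⟨m, hm⟩ : Fin R) ×ˢ (Finset.univ : Finset Bool)) \ Finset.univ.image f.1 := by
    ext ⟨r, b⟩
    simp [Fin.le_def]
  rw [h1, Finset.card_sdiff_of_subset, Finset.card_product, Finset.card_image_of_injective _ f.2.1]
  · simp; omega
  · intro s hs
    simp only [Finset.mem_image, Finset.mem_univ, true_and] at hs
    obtain ⟨i, rfl⟩ := hs
    simp only [Finset.mem_product, Finset.mem_Iic, Finset.mem_univ, and_true, Fin.le_def]
    have := f.2.2 i
    have := i.isLt
    omega

theorem pos_card (m R : ℕ) (hm : m ≤ R) : Fintype.card (Pos m R) = (m + 1).factorial := by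
  classical
  induction m with
  | zero =>
    rw [zero_add, Nat.factorial_one, Fintype.card_eq_one_iff]
    refine ⟨⟨fun i => i.elim0, fun i => i.elim0, fun i => i.elim0⟩, ?_⟩
    intro y; apply Subtype.ext; funext i; exact i.elim0
  | succ m ih =>
    have e : Pos (m + 1) R ≃ Σ f : Pos m R, {s : Fin R × Bool // (s.1 : ℕ) ≤ m ∧ s ∉ Set.range f.1} :=
      { toFun := fun f => ⟨⟨fun i => f.1 i.castSucc,
            fun i j h => Fin.castSucc_injective _ (f.2.1 h), fun i => f.2.2 i.castSucc⟩,
          ⟨f.1 (Fin.last m), by simpa using f.2.2 (Fin.last m), by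
            rintro ⟨i, hi⟩
            have := f.2.1 hi
            exact absurd this (Fin.castSucc_lt_last i).ne⟩⟩
        invFun := fun g => ⟨Fin.snoc (α := fun _ => Fin R × Bool) g.1.1 g.2.1, by
            constructor
            · intro i j h
              induction i using Fin.lastCases with
              | last =>
                induction j using Fin.lastCases with
                | last => rfl
                | cast j => simp only [Fin.snoc_last, Fin.snoc_castSucc] at h
                            exact absurd ⟨j, h.symm⟩ g.2.2.2
              | cast i =>
                induction j using Fin.lastCases with
                | last => simp only [Fin.snoc_last, Fin.snoc_castSucc] at h
                          exact absurd ⟨i, h⟩ g.2.2.2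
                | cast j => simp only [Fin.snoc_castSucc] at h
                            rw [g.1.2.1 h]
            · intro i
              induction i using Fin.lastCases with
              | last => simpa using g.2.2.1
              | cast i => simpa using g.1.2.2 i⟩
        left_inv := by
          intro f
          apply Subtype.ext
          funext i
          induction i using Fin.lastCases with
          | last => simp
          | cast i => simp
        right_inv := by
          rintro ⟨⟨f, hf⟩, ⟨s, hs⟩⟩
          apply Sigma.subtype_ext
          · simp
          · simp }
    rw [Fintype.card_congr e, Fintype.card_sigma]
    simp only [pos_ext_card m R hm]
    rw [Finset.sum_const, Finset.card_univ, ih (by omega), smul_eq_mul, Nat.factorial_succ (m + 1)]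
    ring

end PairUp

section Unlab

def iotaU (n : ℕ) (l : Fin (n - 2)) : Fin (n - 1) := (idx1 l).rev
def rankU (n : ℕ) (l : Fin (n - 2)) : ℕ := l

theorem iotaU_inj (n : ℕ) : Function.Injective (iotaU n) := by
  intro l l' h
  have := congrArg Fin.val (Fin.rev_injective h)
  exact Fin.ext this

theorem iotaU_val (n : ℕ) (l : Fin (n - 2)) : (iotaU n l : ℕ) + l + 1 = n - 1 := by
  unfold iotaU; rw [Fin.val_rev, idx1_val]; have := l.isLt; omega

theorem mem_iotaU (n : ℕ) (s : Fin (n - 1)) : s ∈ Set.range (iotaU n) ↔ (s : ℕ) ≠ 0 := by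
  constructor
  · rintro ⟨l, rfl⟩; have := iotaU_val n l; have := l.isLt; omega
  · intro h
    refine ⟨⟨n - 2 - s, by have := s.isLt; omega⟩, ?_⟩
    apply Fin.ext
    have := iotaU_val n ⟨n - 2 - s, by have := s.isLt; omega⟩
    have := s.isLt
    simp only at *
    omega

abbrev mp {n : ℕ} (c : Sl n → Fin (n - 1)) (k : Fin (n - 1)) : Multiset (Fin (n - 1)) :=
  {c (k.rev, false), c (k.rev, true)}

theorem mp_count {n : ℕ} (c : Sl n → Fin (n - 1)) (s : Fin (n - 1)) :
    ∑ k, (mp c k).count s = (Finset.univ.filter fun z => c z = s).card := by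
  rw [Finset.card_filter, Fintype.sum_prod_type]
  rw [← Equiv.sum_comp Fin.revPerm]
  refine Finset.sum_congr rfl fun k _ => ?_
  simp only [mp, Multiset.insert_eq_cons, Multiset.count_cons, Multiset.count_singleton,
    Fintype.sum_bool, Fin.revPerm_apply, Fin.rev_rev]
  simp only [eq_comm (a := s)]

theorem valU_iff {n : ℕ} (hn : 4 ≤ n) (c : Sl n → Fin (n - 1)) :
    Val (iotaU n) (rankU n) c ↔ IsUCOMraw n (fun k => mp c k) := by
  unfold Val IsUCOMraw
  simp only [mp_count, Fintype.existsUnique_iff_card_one]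
  have hcon : (∀ (l : Fin (n - 2)) (s : Sl n), c s = iotaU n l → (s.1 : ℕ) ≤ rankU n l) ↔
      (∀ (j k : Fin (n - 1)), (j : ℕ) ≠ 0 → j ∈ mp c k → (j : ℕ) ≤ (k : ℕ)) := by
    constructor
    · intro h j k hj hm
      obtain ⟨l, rfl⟩ := (mem_iotaU n j).2 hj
      have hv := iotaU_val n l
      simp only [mp, Multiset.insert_eq_cons, Multiset.mem_cons, Multiset.mem_singleton] at hm
      rcases hm with hm | hm
      · have := h l _ hm.symm
        simp only [Fin.val_rev, rankU] at this; have := k.isLt; omega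
      · have := h l _ hm.symm
        simp only [Fin.val_rev, rankU] at this; have := k.isLt; omega
    · rintro h l ⟨r, b⟩ hs
      have hv := iotaU_val n l
      have := h (iotaU n l) r.rev ((mem_iotaU n _).1 ⟨l, rfl⟩) (by
        simp only [mp, Multiset.insert_eq_cons, Multiset.mem_cons, Multiset.mem_singleton, Fin.rev_rev]
        cases b
        · left; exact hs.symm
        · right; exact hs.symm)
      simp only [Fin.val_rev] at this
      have := r.isLt
      have := l.isLt
      simp only [rankU]
      omega
  have hcnt : (∀ l : Fin (n - 2), (Finset.univ.filter fun z => c z = iotaU n l).card = 1) ↔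
      (∀ s : Fin (n - 1), (Finset.univ.filter fun z => c z = s).card = if (s : ℕ) = 0 then n else 1) := by
    constructor
    · intro h
      have h1 : ∀ s : Fin (n - 1), (s : ℕ) ≠ 0 → (Finset.univ.filter fun z => c z = s).card = 1 := by
        intro s hs
        obtain ⟨l, rfl⟩ := (mem_iotaU n s).2 hs
        exact h l
      intro s
      split_ifs with hs
      · have htot : ∑ s, (Finset.univ.filter fun z => c z = s).card = (n - 1) * 2 := by
          have := Finset.card_eq_sum_card_fiberwise (s := (Finset.univ : Finset (Sl n)))
            (t := Finset.univ) (f := c) (fun _ _ => Finset.mem_coe.2 (Finset.mem_univ _))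
          rw [← this]; simp
        rw [← Finset.add_sum_erase _ _ (Finset.mem_univ s)] at htot
        have h2 : ∑ x ∈ Finset.univ.erase s, (Finset.univ.filter fun z => c z = x).card =
            ∑ x ∈ Finset.univ.erase s, 1 := by
          refine Finset.sum_congr rfl fun x hx => h1 x ?_
          intro hx0
          exact (Finset.mem_erase.1 hx).1 (Fin.ext (by omega))
        rw [h2] at htot
        simp only [Finset.sum_const, Finset.card_erase_of_mem (Finset.mem_univ s), Finset.card_univ,
          Fintype.card_fin, smul_eq_mul, mul_one] at htot
        omega
      · exact h1 s hs
    · intro h l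
      rw [h, if_neg ((mem_iotaU n _).1 ⟨l, rfl⟩)]
  rw [hcon, hcnt]
  constructor
  · rintro ⟨h1, h2⟩; exact ⟨fun k => by simp [mp], h1, h2⟩
  · rintro ⟨_, h1, h2⟩; exact ⟨h1, h2⟩

abbrev StU (n : ℕ) := St n (iotaU n) (rankU n)

def hU {n : ℕ} (hn : 4 ≤ n) (x : StU n) : UCOM n :=
  ⟨fun k => ⟨mp x.1 k, by simp [mp]⟩, (valU_iff hn x.1).1 x.2⟩

theorem uraw_hU {n : ℕ} (hn : 4 ≤ n) (x : StU n) : uraw n (hU hn x) = fun k => mp x.1 k := rfl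

theorem uraw_inj {n : ℕ} {x y : UCOM n} (h : uraw n x = uraw n y) : x = y := by
  apply Subtype.ext; funext k
  exact Subtype.ext (congrFun h k)

theorem hU_eq_iff {n : ℕ} (hn : 4 ≤ n) (x : StU n) (y : UCOM n) :
    hU hn x = y ↔ (fun k => ({x.1 (k.rev, false), x.1 (k.rev, true)} : Multiset (Fin (n - 1)))) = uraw n y := by
  constructor
  · rintro rfl; rfl
  · intro h; exact uraw_inj h

theorem pair_flip {α : Type*} (f : Bool → α) (g : Bool) :
    ({f (xor false g), f (xor true g)} : Multiset α) = {f false, f true} := by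
  cases g
  · rfl
  · exact Multiset.pair_comm _ _

theorem hU_flip {n : ℕ} (hn : 4 ≤ n) (g : Fin (n - 1) → Bool) (c : StU n) :
    hU hn (flipSt g c) = hU hn c := by
  apply uraw_inj
  funext k
  exact pair_flip (fun b => c.1 (k.rev, b)) (g k.rev)

theorem swp_ne {n : ℕ} (u : Fin (n - 2)) (a b : Bool) (r : Fin (n - 1)) (d : Bool)
    (h1 : r ≠ idx1 u) (h2 : r ≠ idx2 u) : swp (u, a, b) (r, d) = (r, d) := by
  apply Equiv.swap_apply_of_ne_of_ne
  · intro h; exact h1 (Prod.ext_iff.1 h).1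
  · intro h; exact h2 (Prod.ext_iff.1 h).1

theorem swp_o1 {n : ℕ} (u : Fin (n - 2)) (a b : Bool) : swp (u, a, b) (idx1 u, !a) = (idx1 u, !a) := by
  apply Equiv.swap_apply_of_ne_of_ne
  · simp
  · intro h; exact idx_ne u (Prod.ext_iff.1 h).1

theorem swp_o2 {n : ℕ} (u : Fin (n - 2)) (a b : Bool) : swp (u, a, b) (idx2 u, !b) = (idx2 u, !b) := by
  apply Equiv.swap_apply_of_ne_of_ne
  · intro h; exact idx_ne u (Prod.ext_iff.1 h).1.symm
  · simp

theorem ms_erase {α : Type*} [DecidableEq α] (f f' : Bool → α) (b : Bool) (v : α) (h1 : f' b = v)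
    (h2 : f' (!b) = f (!b)) :
    v ::ₘ (({f false, f true} : Multiset α).erase (f b)) = {f' false, f' true} := by
  cases b
  · simp only [Bool.not_false] at h2
    rw [h1, h2, Multiset.insert_eq_cons, Multiset.erase_cons_head]; rfl
  · simp only [Bool.not_true] at h2
    rw [Multiset.pair_comm (f false), h1, h2, Multiset.insert_eq_cons, Multiset.erase_cons_head,
      Multiset.pair_comm]; rfl

theorem uswap_eq {n : ℕ} (c : Sl n → Fin (n - 1)) (u : Fin (n - 2)) (a b : Bool) :
    uswapFun n (fun k => mp c k) u.rev (c (idx2 u, b)) (c (idx1 u, a)) =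
      fun k => mp (fun s => c (swp (u, a, b) s)) k := by
  funext k
  unfold uswapFun
  split_ifs with h1 h2
  · subst h1
    simp only [mp, rev_idx1, Fin.rev_rev]
    exact ms_erase (fun d => c (idx2 u, d)) (fun d => c (swp (u, a, b) (idx2 u, d))) b _
      (by simp only [swp_two]) (by simp only [swp_o2])
  · subst h2
    simp only [mp, rev_idx2, Fin.rev_rev]
    exact ms_erase (fun d => c (idx1 u, d)) (fun d => c (swp (u, a, b) (idx1 u, d))) a _
      (by simp only [swp_one]) (by simp only [swp_o1])
  · have e1 : k.rev ≠ idx1 u := by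
      intro h; apply h2; rw [← Fin.rev_rev k, h, rev_idx1]
    have e2 : k.rev ≠ idx2 u := by
      intro h; apply h1; rw [← Fin.rev_rev k, h, rev_idx2]
    simp only [mp, swp_ne u a b _ _ e1 e2]

theorem uswapDest_eq {n : ℕ} (hn : 4 ≤ n) (x : StU n) (u : Fin (n - 2)) (a b : Bool) :
    uswapDest n (hU hn x) u.rev (x.1 (idx2 u, b)) (x.1 (idx1 u, a)) =
      uraw n (hU hn (TT (u, a, b) x)) := by
  unfold uswapDest
  rw [uraw_hU, uswap_eq, uraw_hU]
  have key := valU_iff hn (fun s => x.1 (swp (u, a, b) s))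
  unfold TT
  by_cases h : Val (iotaU n) (rankU n) (fun s => x.1 (swp (u, a, b) s))
  · rw [if_pos (key.1 h), dif_pos h]
  · rw [if_neg (fun h' => h (key.2 h')), dif_neg h]

theorem PU_eq {n : ℕ} (hn : 4 ≤ n) (x : StU n) (y : UCOM n) :
    PUmat n (hU hn x) y = (1 / (4 * ((n : ℝ) - 2))) * ∑ ω, if hU hn (TT ω x) = y then 1 else 0 := by
  have hn2 : (0 : ℝ) < (n : ℝ) - 2 := by
    have : (4 : ℝ) ≤ n := by exact_mod_cast hn
    linarith
  have e : ∀ z : UCOM n, (uraw n z = uraw n y) ↔ z = y := fun z => ⟨uraw_inj, fun h => by rw [h]⟩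
  change PU n (hU hn x) y = _
  unfold PU
  rw [Fintype.sum_prod_type, ← Equiv.sum_comp Fin.revPerm, Finset.mul_sum, Finset.mul_sum]
  refine Finset.sum_congr rfl fun u _ => ?_
  simp only [Fin.revPerm_apply]
  rw [uraw_hU]
  simp only [mp, rev_idx1, rev_idx2, Fin.rev_rev, Multiset.insert_eq_cons, Multiset.map_cons,
    Multiset.map_singleton, Multiset.sum_cons, Multiset.sum_singleton, uswapDest_eq, e,
    Fintype.sum_prod_type, Fintype.sum_bool]
  field_simp
  ring

theorem StU_card {n : ℕ} (hn : 4 ≤ n) : Fintype.card (StU n) = (n - 1).factorial := by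
  classical
  have h1 := pos_card (n - 2) (n - 1) (by omega)
  rw [show n - 2 + 1 = n - 1 by omega] at h1
  rw [← h1]
  refine Fintype.card_of_bijective
    (f := fun x : StU n => (⟨sig x, sig_inj (iotaU_inj n) x, sig_bd x⟩ : Pos (n - 2) (n - 1))) ⟨?_, ?_⟩
  · intro x y h
    apply ext_sig _ x y (fun l => congrFun (congrArg Subtype.val h) l)
    intro a b ha hb
    rw [mem_iotaU, not_not] at ha hb
    exact Fin.ext (ha.trans hb.symm)
  · intro f
    let z : Fin (n - 1) := ⟨0, by omega⟩
    let c : Sl n → Fin (n - 1) := fun s => if h : ∃ l, f.1 l = s then iotaU n h.choose else z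
    have hc : ∀ s l, c s = iotaU n l ↔ s = f.1 l := by
      intro s l
      by_cases h : ∃ l, f.1 l = s
      · have e : c s = iotaU n h.choose := dif_pos h
        have hs := h.choose_spec
        rw [e]
        constructor
        · intro h2; rw [← iotaU_inj n h2, hs]
        · intro h2; rw [f.2.1 (hs.trans h2)]
      · have e : c s = z := dif_neg h
        rw [e]
        constructor
        · intro h2
          exact absurd rfl ((mem_iotaU n z).1 ⟨l, h2.symm⟩)
        · intro h2; exact absurd ⟨l, h2.symm⟩ h
    have hv : Val (iotaU n) (rankU n) c := by
      unfold Val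
      simp only [hc]
      refine ⟨fun l => ⟨_, rfl, fun _ h => h⟩, ?_⟩
      rintro l s rfl; exact f.2.2 l
    refine ⟨⟨c, hv⟩, Subtype.ext ?_⟩
    funext l
    exact ((sig_iff (⟨c, hv⟩ : StU n) l (f.1 l)).1 ((hc _ _).2 rfl)).symm

theorem fiberU {n : ℕ} (hn : 4 ≤ n) (y : UCOM n) :
    (Finset.univ.filter fun x : StU n => hU hn x = y).card = 2 ^ (n - cherries n y - 1) := by
  classical
  simp only [hU_eq_iff]
  rw [fiber_card (fun a b => ({a, b} : Multiset (Fin (n - 1)))) (IsUCOMraw n) (valU_iff hn) (uraw n y) y.2]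
  have h1 : ∀ k, (Finset.univ.filter fun q : Fin (n - 1) × Fin (n - 1) =>
      ({q.1, q.2} : Multiset (Fin (n - 1))) = uraw n y k).card =
      if ∀ a ∈ uraw n y k, (a : ℕ) = 0 then 1 else 2 := by
    intro k
    obtain ⟨a, b, hab⟩ := Multiset.card_eq_two.1 (y.2.1 k)
    have hab' : uraw n y k = {a, b} := hab
    rw [hab', ms_pairs]
    have : a = b ↔ ∀ c ∈ ({a, b} : Multiset (Fin (n - 1))), (c : ℕ) = 0 := by
      simp only [Multiset.insert_eq_cons, Multiset.mem_cons, Multiset.mem_singleton, forall_eq_or_imp,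
        forall_eq]
      constructor
      · rintro rfl
        by_contra hc
        have h2 := y.2.2.1 a
        have h3 := Finset.single_le_sum (f := fun k => Multiset.count a (uraw n y k))
          (fun _ _ => Nat.zero_le _) (Finset.mem_univ k)
        change ∑ k, Multiset.count a (uraw n y k) = _ at h2
        rw [h2, if_neg (by tauto)] at h3
        simp [hab'] at h3
      · rintro ⟨h2, h3⟩; exact Fin.ext (h2.trans h3.symm)
    simp only [this]
  simp only [h1]
  rw [Finset.prod_ite]
  simp only [Finset.prod_const_one, one_mul, Finset.prod_const]
  congr 1
  have := Finset.card_filter_add_card_filter_not (s := (Finset.univ : Finset (Fin (n - 1))))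
    (fun k => ∀ a ∈ uraw n y k, (a : ℕ) = 0)
  rw [Finset.card_univ, Fintype.card_fin] at this
  unfold cherries
  omega

theorem tU_bound (n : ℕ) (hn : 4 ≤ n) : (tU n : ℝ) ≤ (8 / 3 : ℝ) * (n : ℝ) ^ 4 := by
  have hn4 : (4 : ℝ) ≤ n := by exact_mod_cast hn
  have hN := Nat.lt_floor_add_one ((8 / 3 : ℝ) * (n : ℝ) ^ 4)
  refine le_trans ?_ (Nat.floor_le (by positivity : (0 : ℝ) ≤ (8 / 3 : ℝ) * (n : ℝ) ^ 4))
  have hcast : ((n - 2 : ℕ) : ℝ) = (n : ℝ) - 2 := by rw [Nat.cast_sub (by omega)]; simp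
  refine Nat.cast_le.2 (gen_bound (ι := iotaU n) (rank := rankU n) hn (iotaU_inj n)
    (fun a b h => Fin.ext h) (n - 2) (fun l => l.isLt) ?_ (hU hn) ?_ (hU_flip hn) _ _ (PU_eq hn) ?_ _
    (lt_of_le_of_lt ?_ hN))
  · intro a b ha hb
    rw [mem_iotaU, not_not] at ha hb
    exact Fin.ext (ha.trans hb.symm)
  · intro y
    have h1 : 0 < (Finset.univ.filter fun x : StU n => hU hn x = y).card := by
      rw [fiberU]; positivity
    obtain ⟨x, hx⟩ := Finset.card_pos.1 h1
    exact ⟨x, (Finset.mem_filter.1 hx).2⟩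
  · intro y
    rw [fiberU, StU_card hn]
    unfold tajima
    push_cast
    rfl
  · rw [hcast]
    have h0 : (0 : ℝ) ≤ (n : ℝ) - 2 := by linarith
    have e1 : ((n : ℝ) - 2) * ((n : ℝ) - 2) ≤ (n : ℝ) * n := by nlinarith
    have e2 : ((n : ℝ) - 2 + 1) * ((n : ℝ) - 2 + 2) ≤ (n : ℝ) * n := by nlinarith
    have e3 := mul_le_mul e1 e2 (by nlinarith) (by positivity)
    nlinarith

end Unlab

section Labld

def rankL (n : ℕ) (l : LLabel n) : ℕ := Sum.elim (fun i : Fin n => n - 2 + (i : ℕ)) (fun j : Fin (n - 2) => n - 3 - (j : ℕ)) l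

theorem rankL_inj (n : ℕ) (hn : 4 ≤ n) : Function.Injective (rankL n) := by
  rintro (i | i) (j | j) h <;> simp only [rankL, Sum.elim_inl, Sum.elim_inr] at h
  · congr 1; apply Fin.ext; omega
  · omega
  · omega
  · congr 1; apply Fin.ext; have := i.isLt; have := j.isLt; omega

theorem rankL_lt (n : ℕ) (hn : 4 ≤ n) (l : LLabel n) : rankL n l < 2 * n - 2 := by
  rcases l with (i | i) <;> simp only [rankL, Sum.elim_inl, Sum.elim_inr]
  · have := i.isLt; omega
  · omega

abbrev fp {n : ℕ} (c : Sl n → LLabel n) (k : Fin (n - 1)) : Finset (LLabel n) :=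
  {c (k.rev, false), c (k.rev, true)}

theorem mem_fp {n : ℕ} (c : Sl n → LLabel n) (k : Fin (n - 1)) (a : LLabel n) :
    a ∈ fp c k ↔ ∃ b, c (k.rev, b) = a := by
  simp only [fp, Finset.mem_insert, Finset.mem_singleton, Bool.exists_bool, eq_comm (a := a)]

theorem val_inj {n : ℕ} {c : Sl n → LLabel n} (h : Val id (rankL n) c) : Function.Injective c := by
  intro s t e
  exact (h.1 (c t)).unique e rfl

theorem valL_iff {n : ℕ} (hn : 4 ≤ n) (c : Sl n → LLabel n) :
    Val id (rankL n) c ↔ IsLCOM n (fun k => fp c k) := by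
  unfold IsLCOM
  constructor
  · intro h
    have hi := val_inj h
    refine ⟨fun k => ?_, fun a => ?_, fun j k hm => ?_⟩
    · apply Finset.card_pair
      intro e; simpa using hi e
    · obtain ⟨⟨r, b⟩, hs, hu⟩ := h.1 a
      refine ⟨r.rev, (mem_fp _ _ _).2 ⟨b, by rw [Fin.rev_rev]; exact hs⟩, fun k' hk => ?_⟩
      obtain ⟨b', hb⟩ := (mem_fp _ _ _).1 hk
      have := (Prod.ext_iff.1 (hu _ hb)).1
      simp only at this
      rw [← this, Fin.rev_rev]
    · obtain ⟨b', hb⟩ := (mem_fp _ _ _).1 hm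
      have := h.2 (Sum.inr j) _ hb
      simp only [rankL, Sum.elim_inr, Fin.val_rev] at this
      have := k.isLt; have := j.isLt
      omega
  · rintro ⟨h1, h2, h3⟩
    refine ⟨fun l => ?_, ?_⟩
    · obtain ⟨k, hk, hu⟩ := h2 l
      obtain ⟨b, hb⟩ := (mem_fp _ _ _).1 hk
      refine ⟨(k.rev, b), hb, ?_⟩
      rintro ⟨r, d⟩ hd
      have e : r.rev = k := hu _ ((mem_fp _ _ _).2 ⟨d, by rw [Fin.rev_rev]; exact hd⟩)
      subst e
      rw [Fin.rev_rev] at hb ⊢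
      have hne : c (r, false) ≠ c (r, true) := by
        intro e
        have := h1 r.rev
        simp [fp, e] at this
      have hd' : c (r, d) = l := hd
      have hb' : c (r, b) = l := hb
      have : d = b := by
        cases d <;> cases b
        · rfl
        · exact absurd (hd'.trans hb'.symm) hne
        · exact absurd (hb'.trans hd'.symm) hne
        · rfl
      rw [this]
    · rintro (i | j) ⟨r, d⟩ hd
      · simp only [rankL, Sum.elim_inl]; have := r.isLt; omega
      · have := h3 j r.rev ((mem_fp _ _ _).2 ⟨d, by rw [Fin.rev_rev]; exact hd⟩)
        simp only [rankL, Sum.elim_inr]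
        simp only [Fin.val_rev] at this
        have := r.isLt; have := j.isLt
        omega

abbrev StL (n : ℕ) := St n (id : LLabel n → LLabel n) (rankL n)

def hL {n : ℕ} (hn : 4 ≤ n) (x : StL n) : LCOM n :=
  ⟨fun k => fp x.1 k, (valL_iff hn x.1).1 x.2⟩

theorem hL_val {n : ℕ} (hn : 4 ≤ n) (x : StL n) : (hL hn x).val = fun k => fp x.1 k := rfl

theorem hL_eq_iff {n : ℕ} (hn : 4 ≤ n) (x : StL n) (y : LCOM n) :
    hL hn x = y ↔ (fun k => ({x.1 (k.rev, false), x.1 (k.rev, true)} : Finset (LLabel n))) = y.1 := by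
  constructor
  · rintro rfl; rfl
  · intro h; exact Subtype.ext h

theorem fpair_flip {α : Type*} [DecidableEq α] (f : Bool → α) (g : Bool) :
    ({f (xor false g), f (xor true g)} : Finset α) = {f false, f true} := by
  cases g
  · rfl
  · exact Finset.pair_comm _ _

theorem hL_flip {n : ℕ} (hn : 4 ≤ n) (g : Fin (n - 1) → Bool) (c : StL n) :
    hL hn (flipSt g c) = hL hn c := by
  apply Subtype.ext
  funext k
  exact fpair_flip (fun b => c.1 (k.rev, b)) (g k.rev)

theorem fs_erase {α : Type*} [DecidableEq α] (f f' : Bool → α) (b : Bool) (v : α) (h1 : f' b = v)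
    (h2 : f' (!b) = f (!b)) (hne : f false ≠ f true) :
    insert v (({f false, f true} : Finset α).erase (f b)) = {f' false, f' true} := by
  cases b
  · simp only [Bool.not_false] at h2
    rw [h1, h2, Finset.erase_insert (by simpa using hne)]
  · simp only [Bool.not_true] at h2
    rw [Finset.pair_comm (f false), h1, h2, Finset.erase_insert (by simpa using hne.symm),
      Finset.pair_comm]

theorem lswap_eq {n : ℕ} (c : Sl n → LLabel n) (hi : Function.Injective c) (u : Fin (n - 2)) (a b : Bool) :
    lswapFun n (fun k => fp c k) u.rev (c (idx2 u, b)) (c (idx1 u, a)) =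
      fun k => fp (fun s => c (swp (u, a, b) s)) k := by
  have hne : ∀ r, c (r, false) ≠ c (r, true) := by
    intro r e; simpa using hi e
  funext k
  unfold lswapFun
  split_ifs with h1 h2
  · subst h1
    simp only [fp, rev_idx1, Fin.rev_rev]
    exact fs_erase (fun d => c (idx2 u, d)) (fun d => c (swp (u, a, b) (idx2 u, d))) b _
      (by simp only [swp_two]) (by simp only [swp_o2]) (hne _)
  · subst h2
    simp only [fp, rev_idx2, Fin.rev_rev]
    exact fs_erase (fun d => c (idx1 u, d)) (fun d => c (swp (u, a, b) (idx1 u, d))) a _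
      (by simp only [swp_one]) (by simp only [swp_o1]) (hne _)
  · have e1 : k.rev ≠ idx1 u := by
      intro h; apply h2; rw [← Fin.rev_rev k, h, rev_idx1]
    have e2 : k.rev ≠ idx2 u := by
      intro h; apply h1; rw [← Fin.rev_rev k, h, rev_idx2]
    simp only [fp, swp_ne u a b _ _ e1 e2]

theorem lswapDest_eq {n : ℕ} (hn : 4 ≤ n) (x : StL n) (u : Fin (n - 2)) (a b : Bool) :
    lswapDest n (hL hn x) u.rev (x.1 (idx2 u, b)) (x.1 (idx1 u, a)) =
      (hL hn (TT (u, a, b) x)).val := by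
  unfold lswapDest
  rw [hL_val, lswap_eq _ (val_inj x.2), hL_val]
  have key := valL_iff hn (fun s => x.1 (swp (u, a, b) s))
  unfold TT
  by_cases h : Val id (rankL n) (fun s => x.1 (swp (u, a, b) s))
  · rw [if_pos (key.1 h), dif_pos h]
  · rw [if_neg (fun h' => h (key.2 h')), dif_neg h]

theorem PL_eq {n : ℕ} (hn : 4 ≤ n) (x : StL n) (y : LCOM n) :
    PLmat n (hL hn x) y = (1 / (4 * ((n : ℝ) - 2))) * ∑ ω, if hL hn (TT ω x) = y then 1 else 0 := by
  have hn2 : (0 : ℝ) < (n : ℝ) - 2 := by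
    have : (4 : ℝ) ≤ n := by exact_mod_cast hn
    linarith
  have e : ∀ z : LCOM n, (z.val = y.val) ↔ z = y := fun z => ⟨Subtype.ext, fun h => by rw [h]⟩
  have hne : ∀ r, x.1 (r, false) ≠ x.1 (r, true) := by
    intro r e; simpa using val_inj x.2 e
  change PL n (hL hn x) y = _
  unfold PL
  rw [Fintype.sum_prod_type, ← Equiv.sum_comp Fin.revPerm, Finset.mul_sum, Finset.mul_sum]
  refine Finset.sum_congr rfl fun u _ => ?_
  simp only [Fin.revPerm_apply]
  rw [hL_val]
  simp only [fp, rev_idx1, rev_idx2, Fin.rev_rev, Finset.sum_pair (hne _), lswapDest_eq, e,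
    Fintype.sum_prod_type, Fintype.sum_bool]
  field_simp
  ring

theorem fiberL {n : ℕ} (hn : 4 ≤ n) (y : LCOM n) :
    (Finset.univ.filter fun x : StL n => hL hn x = y).card = 2 ^ (n - 1) := by
  classical
  simp only [hL_eq_iff]
  rw [fiber_card (fun a b => ({a, b} : Finset (LLabel n))) (IsLCOM n) (valL_iff hn) y.1 y.2]
  rw [Finset.prod_congr rfl fun k _ => fs_pairs (y.1 k) (y.2.1 k)]
  simp

theorem StL_card {n : ℕ} (hn : 4 ≤ n) : Fintype.card (StL n) = Fintype.card (LCOM n) * 2 ^ (n - 1) := by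
  have := Finset.card_eq_sum_card_fiberwise (s := (Finset.univ : Finset (StL n)))
    (t := Finset.univ) (f := hL hn) (fun _ _ => Finset.mem_coe.2 (Finset.mem_univ _))
  rw [← Finset.card_univ, this]
  simp only [fiberL hn, Finset.sum_const, Finset.card_univ, smul_eq_mul]

theorem tL_bound (n : ℕ) (hn : 4 ≤ n) : (tL n : ℝ) ≤ (11 : ℝ) * (n : ℝ) ^ 4 := by
  have hn4 : (4 : ℝ) ≤ n := by exact_mod_cast hn
  have hN := Nat.lt_floor_add_one ((11 : ℝ) * (n : ℝ) ^ 4)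
  refine le_trans ?_ (Nat.floor_le (by positivity : (0 : ℝ) ≤ (11 : ℝ) * (n : ℝ) ^ 4))
  have hcast : ((2 * n - 2 : ℕ) : ℝ) = 2 * (n : ℝ) - 2 := by rw [Nat.cast_sub (by omega)]; simp
  refine Nat.cast_le.2 (gen_bound (ι := (id : LLabel n → LLabel n)) (rank := rankL n) hn
    Function.injective_id (rankL_inj n hn) (2 * n - 2) (rankL_lt n hn) ?_ (hL hn) ?_ (hL_flip hn) _ _
    (PL_eq hn) ?_ _ (lt_of_le_of_lt ?_ hN))
  · intro a b ha hb
    exact absurd ⟨a, rfl⟩ ha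
  · intro y
    have h1 : 0 < (Finset.univ.filter fun x : StL n => hL hn x = y).card := by
      rw [fiberL]; positivity
    obtain ⟨x, hx⟩ := Finset.card_pos.1 h1
    exact ⟨x, (Finset.mem_filter.1 hx).2⟩
  · intro y
    rw [fiberL, StL_card hn]
    unfold unifL
    have h1 : (0 : ℝ) < Fintype.card (LCOM n) := by
      exact_mod_cast Fintype.card_pos_iff.2 ⟨y⟩
    push_cast
    field_simp
  · rw [hcast]
    have h0 : (0 : ℝ) ≤ (n : ℝ) - 2 := by linarith
    have e1 : ((n : ℝ) - 2) * (2 * (n : ℝ) - 2) ≤ 2 * ((n : ℝ) * n) := by nlinarith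
    have e2 : (2 * (n : ℝ) - 2 + 1) * (2 * (n : ℝ) - 2 + 2) ≤ 4 * ((n : ℝ) * n) := by nlinarith
    have e3 := mul_le_mul e1 e2 (by nlinarith) (by positivity)
    have e4 : (0 : ℝ) ≤ (n : ℝ) ^ 4 := by positivity
    nlinarith

end Labld

/-- For `n ≥ 4`, the mixing time of the adjacent-swap chain on `COM_n`
satisfies `t_n ≤ (8/3)·n⁴`, and there is a constant `C > 0` with `t_n^L ≤ C·n⁴` for all
`n ≥ 4`. -/
theorem stmt17 :
    (∀ n : ℕ, 4 ≤ n → (tU n : ℝ) ≤ (8 / 3 : ℝ) * (n : ℝ) ^ 4) ∧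
    ∃ C : ℝ, 0 < C ∧ ∀ n : ℕ, 4 ≤ n → (tL n : ℝ) ≤ C * (n : ℝ) ^ 4 := by

  exact ⟨tU_bound, 11, by norm_num, tL_bound⟩
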